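/- (a) If y : ℂ → ℂ satisfies y(q^{−2}z) + (q^{−3} z² (1+q^{−1}) − (1+q^{−1})) y(q^{−1}z) + q^{−1}(1+q^{−4} z⁴) y(z) = 0 for all z, then u(z) := y(z) g(z)^{−1} satisfies q^{−5} u(q^{−2}z) + q^{−1}(z^{−2}(1+q^{−1}) − q^{−3}(1+q^{−1})) u(q^{−1}z) + (z^{−4} + q^{−4}) u(z) = 0 at every z where all the quantities involved are defined. (b) There exist functions φ_even(z) = Σ_{j=0}^{∞} u_{2j} z^{−2j} with u_0 = 1 and φ_odd(z) = Σ_{j=0}^{∞} u_{2j+1} z^{−2j−1} with u_1 = 1, both series converging (hence defining holomorphic functions) on {z ∈ ℂ : |z| > q}, each of which satisfies q^{−5} u(q^{−2}z) + q^{−1}(z^{−2}(1+q^{−1}) − q^{−3}(1+q^{−1})) u(q^{−1}z) + (z^{−4} + q^{−4}) u(z) = 0 for all |z| > q. -/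

import Mathlib

open Complex Topology

/-- The q-Pochhammer symbol `(a;qq)_∞ = ∏_{j=0}^∞ (1 - a qq^j)`. -/
noncomputable def qpoch (a qq : ℂ) : ℂ := ∏' j : ℕ, (1 - a * qq ^ j)

/-- `g(z) = (z²;q²)_∞ (q² z⁻²;q²)_∞`. -/
noncomputable def gfun (q : ℝ) (z : ℂ) : ℂ :=
  qpoch (z ^ 2) ((q : ℂ) ^ 2) * qpoch ((q : ℂ) ^ 2 * z⁻¹ ^ 2) ((q : ℂ) ^ 2)

/-- The q-difference equation
`y(q⁻²z) + (q⁻³ z² (1+q⁻¹) − (1+q⁻¹)) y(q⁻¹z) + q⁻¹ (1+q⁻⁴ z⁴) y(z) = 0`,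
required at every `z ∈ ℂ`. -/
def NearEq (q : ℝ) (y : ℂ → ℂ) : Prop :=
  ∀ z : ℂ,
    y ((q : ℂ)⁻¹ ^ 2 * z)
      + ((q : ℂ)⁻¹ ^ 3 * z ^ 2 * (1 + (q : ℂ)⁻¹) - (1 + (q : ℂ)⁻¹)) * y ((q : ℂ)⁻¹ * z)
      + (q : ℂ)⁻¹ * (1 + (q : ℂ)⁻¹ ^ 4 * z ^ 4) * y z = 0

/-- The q-difference equation
`q⁻⁵ u(q⁻²z) + q⁻¹(z⁻²(1+q⁻¹) − q⁻³(1+q⁻¹)) u(q⁻¹z) + (z⁻⁴ + q⁻⁴) u(z) = 0` at the point `z`. -/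
def UEqAt (q : ℝ) (u : ℂ → ℂ) (z : ℂ) : Prop :=
  (q : ℂ)⁻¹ ^ 5 * u ((q : ℂ)⁻¹ ^ 2 * z)
    + (q : ℂ)⁻¹ * (z⁻¹ ^ 2 * (1 + (q : ℂ)⁻¹) - (q : ℂ)⁻¹ ^ 3 * (1 + (q : ℂ)⁻¹)) *
        u ((q : ℂ)⁻¹ * z)
    + (z⁻¹ ^ 4 + (q : ℂ)⁻¹ ^ 4) * u z = 0

theorem qpoch_eq_one_sub_mul (a : ℂ) {p : ℂ} (hp : ‖p‖ < 1) :
    qpoch a p = (1 - a) * qpoch (a * p) p := by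
  have hm : Multipliable fun j : ℕ => 1 - a * p ^ (j + 1) := by
    have hs : Summable fun j : ℕ => ‖-(a * p ^ (j + 1))‖ := by
      have := ((summable_geometric_of_lt_one (norm_nonneg p) hp).mul_left (‖a‖ * ‖p‖))
      refine this.congr fun j => ?_
      simp only [norm_neg, norm_mul, norm_pow]
      ring
    simpa only [sub_eq_add_neg] using multipliable_one_add_of_summable hs
  have h := tprod_eq_zero_mul' (f := fun j : ℕ => 1 - a * p ^ j) hm
  simp only [pow_zero, mul_one, pow_succ'] at h
  simp only [qpoch, mul_assoc, h]

theorem gfun_inv_mul {q : ℝ} (hq0 : 0 < q) (hq1 : q < 1) {z : ℂ} (hz : z ≠ 0) :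
    gfun q ((q : ℂ)⁻¹ * z) = -((q : ℂ)⁻¹ ^ 2 * z ^ 2) * gfun q z := by
  have hq : (q : ℂ) ≠ 0 := by exact_mod_cast hq0.ne'
  have hp : ‖(q : ℂ) ^ 2‖ < 1 := by
    rw [norm_pow, Complex.norm_real, Real.norm_of_nonneg hq0.le]
    exact pow_lt_one₀ hq0.le hq1 two_ne_zero
  have h1 := qpoch_eq_one_sub_mul (((q : ℂ)⁻¹ * z) ^ 2) hp
  have h2 := qpoch_eq_one_sub_mul ((q : ℂ) ^ 2 * z⁻¹ ^ 2) hp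
  have e1 : ((q : ℂ)⁻¹ * z) ^ 2 * (q : ℂ) ^ 2 = z ^ 2 := by field_simp
  have e2 : (q : ℂ) ^ 2 * ((q : ℂ)⁻¹ * z)⁻¹ ^ 2 = (q : ℂ) ^ 2 * z⁻¹ ^ 2 * (q : ℂ) ^ 2 := by
    field_simp
  rw [e1] at h1
  unfold gfun
  rw [h1, h2, e2]
  field_simp
  ring

theorem UEqAt.of_nearEq {q : ℝ} (hq0 : 0 < q) (hq1 : q < 1) {y : ℂ → ℂ} (hy : NearEq q y)
    {z : ℂ} (hz : z ≠ 0) :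
    UEqAt q (fun t => y t * (gfun q t)⁻¹) z := by
  have hq : (q : ℂ) ≠ 0 := by exact_mod_cast hq0.ne'
  have h1 := gfun_inv_mul hq0 hq1 hz
  have h2 := gfun_inv_mul hq0 hq1 (mul_ne_zero (inv_ne_zero hq) hz)
  rw [← mul_assoc, ← sq, h1] at h2
  have h := hy z
  unfold UEqAt
  dsimp only
  rw [h2, h1]
  generalize y ((q : ℂ)⁻¹ ^ 2 * z) = y2 at *
  generalize y ((q : ℂ)⁻¹ * z) = y1 at *
  generalize y z = y0 at *
  generalize gfun q z = g at *
  trans (q * z⁻¹ ^ 4 * g⁻¹) * (y2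
      + ((q : ℂ)⁻¹ ^ 3 * z ^ 2 * (1 + (q : ℂ)⁻¹) - (1 + (q : ℂ)⁻¹)) * y1
      + (q : ℂ)⁻¹ * (1 + (q : ℂ)⁻¹ ^ 4 * z ^ 4) * y0)
  · field_simp
    ring
  · rw [h, mul_zero]

/-- Coefficients `u_{2j+e}` of the power series solution in `z⁻¹` starting with `z⁻ᵉ`. -/
noncomputable def uCoeff (q : ℝ) (e : ℕ) : ℕ → ℝ
  | 0 => 1
  | 1 => -((1 + q) * q ^ (e + 3)) / ((1 - q ^ (e + 2)) * (q - q ^ (e + 2)))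
  | j + 2 => -((1 + q) * q ^ (2 * j + e + 5) * uCoeff q e (j + 1) + q ^ 5 * uCoeff q e j) /
      ((1 - q ^ (2 * j + e + 4)) * (q - q ^ (2 * j + e + 4)))

theorem one_sub_pow_mul_sub_pow_pos {q : ℝ} (hq0 : 0 < q) (hq1 : q < 1) {n : ℕ} (hn : 2 ≤ n) :
    0 < (1 - q ^ n) * (q - q ^ n) := by
  have h1 : q ^ n < q := by
    simpa using pow_lt_pow_right_of_lt_one₀ hq0 hq1 (show 1 < n by omega)
  exact mul_pos (by linarith) (by linarith)

/-- A root-test bound for sequences dominated by a second-order recursion. -/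
theorem summable_mul_pow_of_le_recursion {c A B : ℕ → ℝ} {b r : ℝ} (hc : ∀ j, 0 ≤ c j)
    (hA0 : ∀ j, 0 ≤ A j) (hB0 : ∀ j, 0 ≤ B j)
    (hrec : ∀ j, c (j + 2) ≤ A j * c (j + 1) + B j * c j)
    (hA : Filter.Tendsto A Filter.atTop (𝓝 0)) (hB : Filter.Tendsto B Filter.atTop (𝓝 b))
    (hr : 0 ≤ r) (hbr : b * r ^ 2 < 1) :
    Summable fun j => c j * r ^ j := by
  obtain ⟨s, hrs, hbs⟩ : ∃ s, r < s ∧ b * s ^ 2 < 1 := by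
    have hcont : Filter.Tendsto (fun s : ℝ => b * s ^ 2) (𝓝[>] r) (𝓝 (b * r ^ 2)) :=
      (Continuous.tendsto (by fun_prop) r).mono_left nhdsWithin_le_nhds
    exact (eventually_mem_nhdsWithin.and (hcont.eventually_lt_const hbr)).exists
  have hs : 0 < s := hr.trans_lt hrs
  have hlim : Filter.Tendsto (fun j => A j * s + B j * s ^ 2) Filter.atTop (𝓝 (b * s ^ 2)) := by
    simpa using (hA.mul_const s).add (hB.mul_const (s ^ 2))
  obtain ⟨N, hN⟩ := Filter.eventually_atTop.1 (hlim.eventually_lt_const hbs)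
  set M := max (c N * s ^ N) (c (N + 1) * s ^ (N + 1))
  have hbound : ∀ j, c (N + j) * s ^ (N + j) ≤ M ∧ c (N + j + 1) * s ^ (N + j + 1) ≤ M := by
    intro j
    induction j with
    | zero => exact ⟨le_max_left _ _, le_max_right _ _⟩
    | succ j ih =>
      refine ⟨ih.2, ?_⟩
      have hM : 0 ≤ M := (mul_nonneg (hc _) (pow_nonneg hs.le _)).trans ih.1
      calc c (N + j + 2) * s ^ (N + j + 2)
          ≤ (A (N + j) * c (N + j + 1) + B (N + j) * c (N + j)) * s ^ (N + j + 2) := by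
            gcongr
            exact hrec _
        _ = A (N + j) * s * (c (N + j + 1) * s ^ (N + j + 1))
            + B (N + j) * s ^ 2 * (c (N + j) * s ^ (N + j)) := by ring
        _ ≤ A (N + j) * s * M + B (N + j) * s ^ 2 * M := by
            have := hA0 (N + j)
            have := hB0 (N + j)
            gcongr
            exacts [ih.2, ih.1]
        _ = (A (N + j) * s + B (N + j) * s ^ 2) * M := by ring
        _ ≤ 1 * M := by
            gcongr
            exact (hN _ (by omega)).le
        _ = M := one_mul M
  have hgeo : Summable fun j : ℕ => M * (r / s) ^ j :=
    (summable_geometric_of_lt_one (by positivity) ((div_lt_one hs).2 hrs)).mul_left M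
  refine (summable_nat_add_iff N).1 (Summable.of_nonneg_of_le
    (fun j => mul_nonneg (hc _) (pow_nonneg hr _)) (fun j => ?_) ((summable_nat_add_iff N).2 hgeo))
  rw [add_comm j N]
  calc c (N + j) * r ^ (N + j) = c (N + j) * s ^ (N + j) * (r / s) ^ (N + j) := by
        rw [mul_assoc, ← mul_pow, mul_div_cancel₀ _ hs.ne']
    _ ≤ M * (r / s) ^ (N + j) := by
        gcongr
        exact (hbound j).1

theorem summable_abs_uCoeff_mul_pow {q : ℝ} (hq0 : 0 < q) (hq1 : q < 1) (e : ℕ) {r : ℝ}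
    (hr : 0 ≤ r) (hqr : q ^ 4 * r ^ 2 < 1) : Summable fun j => |uCoeff q e j| * r ^ j := by
  have hD : ∀ j : ℕ, 0 < (1 - q ^ (2 * j + e + 4)) * (q - q ^ (2 * j + e + 4)) := fun j =>
    one_sub_pow_mul_sub_pow_pos hq0 hq1 (by omega)
  have hpow : ∀ k : ℕ, Filter.Tendsto (fun j : ℕ => q ^ (2 * j + e + k)) Filter.atTop (𝓝 0) :=
    fun k => (tendsto_pow_atTop_nhds_zero_of_lt_one hq0.le hq1).comp
      (Filter.tendsto_atTop_mono (fun j => by simp only [id]; omega) Filter.tendsto_id)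
  have hDlim : Filter.Tendsto
      (fun j : ℕ => (1 - q ^ (2 * j + e + 4)) * (q - q ^ (2 * j + e + 4))) Filter.atTop (𝓝 q) := by
    simpa using ((hpow 4).const_sub 1).mul ((hpow 4).const_sub q)
  refine summable_mul_pow_of_le_recursion
    (A := fun j => (1 + q) * q ^ (2 * j + e + 5) /
      ((1 - q ^ (2 * j + e + 4)) * (q - q ^ (2 * j + e + 4))))
    (B := fun j => q ^ 5 / ((1 - q ^ (2 * j + e + 4)) * (q - q ^ (2 * j + e + 4))))
    (b := q ^ 5 / q) (fun j => abs_nonneg _) (fun j => div_nonneg (by positivity) (hD j).le)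
    (fun j => div_nonneg (by positivity) (hD j).le) (fun j => ?_) ?_ ?_ hr ?_
  · rw [uCoeff, abs_div, abs_of_pos (hD j), abs_neg, div_mul_eq_mul_div, div_mul_eq_mul_div,
      ← add_div]
    refine div_le_div_of_nonneg_right ((abs_add_le _ _).trans_eq ?_) (hD j).le
    rw [abs_mul, abs_mul (q ^ 5), abs_of_pos (show 0 < (1 + q) * q ^ (2 * j + e + 5) by positivity),
      abs_of_pos (show 0 < q ^ 5 by positivity)]
  · simpa [Pi.div_def] using ((hpow 5).const_mul (1 + q)).div hDlim hq0.ne'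
  · exact tendsto_const_nhds.div hDlim hq0.ne'
  · convert hqr using 2
    field_simp

theorem summable_uCoeff {q : ℝ} (hq0 : 0 < q) (hq1 : q < 1) (e : ℕ) {x : ℂ}
    (hx : q * ‖x‖ < 1) : Summable fun j : ℕ => (uCoeff q e j : ℂ) * x ^ (2 * j + e) := by
  have h : q ^ 4 * (‖x‖ ^ 2) ^ 2 < 1 := by
    have := pow_lt_one₀ (by positivity) hx (show 4 ≠ 0 by norm_num)
    calc _ = (q * ‖x‖) ^ 4 := by ring
      _ < 1 := this
  refine Summable.of_norm (((summable_abs_uCoeff_mul_pow hq0 hq1 e (by positivity) h).mul_right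
    (‖x‖ ^ e)).congr fun j => ?_)
  rw [norm_mul, norm_pow, Complex.norm_real, Real.norm_eq_abs]
  ring

theorem tsum_add_tsum_add_tsum_eq_zero {f g h : ℕ → ℂ} (hf : Summable f) (hg : Summable g)
    (hh : Summable h) (h0 : f 0 = 0) (h1 : f 1 + g 0 = 0)
    (h2 : ∀ j, f (j + 2) + g (j + 1) + h j = 0) :
    ∑' j, f j + ∑' j, g j + ∑' j, h j = 0 := by
  have hf1 : Summable fun j => f (j + 1) := (summable_nat_add_iff 1).2 hf
  have hf2 : Summable fun j => f (j + 1 + 1) := (summable_nat_add_iff 1).2 hf1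
  have hg1 : Summable fun j => g (j + 1) := (summable_nat_add_iff 1).2 hg
  have hz : ∑' j, f (j + 1 + 1) + ∑' j, g (j + 1) + ∑' j, h j = 0 := by
    rw [← hf2.tsum_add hg1, ← (hf2.add hg1).tsum_add hh]
    exact (tsum_congr h2).trans tsum_zero
  rw [hf.tsum_eq_zero_add, hf1.tsum_eq_zero_add, hg.tsum_eq_zero_add]
  linear_combination h0 + h1 + hz

theorem uEqAt_tsum_uCoeff {q : ℝ} (hq0 : 0 < q) (hq1 : q < 1) {e : ℕ} (he : e = 0 ∨ e = 1)
    {z : ℂ} (hz : q < ‖z‖) :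
    UEqAt q (fun t => ∑' j : ℕ, (uCoeff q e j : ℂ) * t⁻¹ ^ (2 * j + e)) z := by
  have hq : (q : ℂ) ≠ 0 := by exact_mod_cast hq0.ne'
  have hz0 : 0 < ‖z‖ := hq0.trans hz
  have hx : q * ‖z⁻¹‖ < 1 := by
    rw [norm_inv, ← div_eq_mul_inv, div_lt_one hz0]
    exact hz
  have hx1 : q * ‖(q : ℂ) * z⁻¹‖ < 1 := by
    rw [norm_mul, Complex.norm_real, Real.norm_of_nonneg hq0.le]
    nlinarith [norm_nonneg z⁻¹]
  have hx2 : q * ‖(q : ℂ) ^ 2 * z⁻¹‖ < 1 := by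
    rw [sq, mul_assoc, norm_mul, Complex.norm_real, Real.norm_of_nonneg hq0.le]
    nlinarith [norm_nonneg ((q : ℂ) * z⁻¹)]
  have e1 : ((q : ℂ)⁻¹ * z)⁻¹ = q * z⁻¹ := by rw [mul_inv, inv_inv]
  have e2 : ((q : ℂ)⁻¹ ^ 2 * z)⁻¹ = q ^ 2 * z⁻¹ := by rw [mul_inv, inv_pow, inv_inv]
  unfold UEqAt
  dsimp only
  rw [e1, e2]
  generalize z⁻¹ = x at *
  have s0 := summable_uCoeff hq0 hq1 e hx
  have s1 := summable_uCoeff hq0 hq1 e hx1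
  have s2 := summable_uCoeff hq0 hq1 e hx2
  have hD : ∀ n : ℕ, 2 ≤ n → (1 - (q : ℂ) ^ n) * (q - (q : ℂ) ^ n) ≠ 0 := fun n hn => by
    exact_mod_cast (one_sub_pow_mul_sub_pow_pos hq0 hq1 hn).ne'
  have key := tsum_add_tsum_add_tsum_eq_zero
    (((s2.mul_left ((q : ℂ)⁻¹ ^ 5)).add
      (s1.mul_left (-((q : ℂ)⁻¹ ^ 4 * (1 + (q : ℂ)⁻¹))))).add (s0.mul_left ((q : ℂ)⁻¹ ^ 4)))
    (s1.mul_left ((q : ℂ)⁻¹ * (1 + (q : ℂ)⁻¹) * x ^ 2)) (s0.mul_left (x ^ 4)) ?_ ?_ ?_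
  · rw [((s2.mul_left _).add (s1.mul_left _)).tsum_add (s0.mul_left _),
      (s2.mul_left _).tsum_add (s1.mul_left _), tsum_mul_left, tsum_mul_left, tsum_mul_left,
      tsum_mul_left, tsum_mul_left] at key
    linear_combination key
  · rcases he with rfl | rfl <;> simp only [uCoeff] <;> push_cast <;> field_simp <;> ring
  · have h := hD (e + 2) (by omega)
    have hc : (uCoeff q e 1 : ℂ) * ((1 - (q : ℂ) ^ (e + 2)) * (q - (q : ℂ) ^ (e + 2))) =
        -((1 + q) * (q : ℂ) ^ (e + 3)) := by
      rw [uCoeff]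
      push_cast
      exact div_mul_cancel₀ _ h
    have hc0 : (uCoeff q e 0 : ℂ) = 1 := by simp [uCoeff]
    rw [hc0]
    field_simp
    linear_combination (x ^ (e + 2)) * hc
  · intro j
    have h := hD (2 * j + e + 4) (by omega)
    have hc : (uCoeff q e (j + 2) : ℂ) *
        ((1 - (q : ℂ) ^ (2 * j + e + 4)) * (q - (q : ℂ) ^ (2 * j + e + 4))) =
        -((1 + q) * (q : ℂ) ^ (2 * j + e + 5) * uCoeff q e (j + 1) + q ^ 5 * uCoeff q e j) := by
      rw [uCoeff]
      push_cast
      exact div_mul_cancel₀ _ h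
    field_simp
    linear_combination (x ^ (2 * j + e + 4)) * hc

theorem statement6 (q : ℝ) (hq0 : 0 < q) (hq1 : q < 1) :
    -- (a)
    (∀ y : ℂ → ℂ, NearEq q y →
      ∀ z : ℂ, z ≠ 0 →
        gfun q z ≠ 0 → gfun q ((q : ℂ)⁻¹ * z) ≠ 0 → gfun q ((q : ℂ)⁻¹ ^ 2 * z) ≠ 0 →
        UEqAt q (fun t => y t * (gfun q t)⁻¹) z) ∧
    -- (b)
    (∃ ce co : ℕ → ℂ,
      ce 0 = 1 ∧ co 0 = 1 ∧
      (∀ z : ℂ, q < ‖z‖ →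
        Summable (fun j : ℕ => ce j * z⁻¹ ^ (2 * j)) ∧
        Summable (fun j : ℕ => co j * z⁻¹ ^ (2 * j + 1))) ∧
      (∀ z : ℂ, q < ‖z‖ → UEqAt q (fun t => ∑' j : ℕ, ce j * t⁻¹ ^ (2 * j)) z) ∧
      (∀ z : ℂ, q < ‖z‖ → UEqAt q (fun t => ∑' j : ℕ, co j * t⁻¹ ^ (2 * j + 1)) z)) := by
  refine ⟨fun y hy z hz _ _ _ => .of_nearEq hq0 hq1 hy hz,
    fun j => uCoeff q 0 j, fun j => uCoeff q 1 j, by simp [uCoeff], by simp [uCoeff],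
    fun z hz => ?_, fun z hz => uEqAt_tsum_uCoeff hq0 hq1 (.inl rfl) hz,
    fun z hz => uEqAt_tsum_uCoeff hq0 hq1 (.inr rfl) hz⟩
  have hx : q * ‖z⁻¹‖ < 1 := by
    rw [norm_inv, ← div_eq_mul_inv, div_lt_one (hq0.trans hz)]
    exact hz
  exact ⟨summable_uCoeff hq0 hq1 0 hx, summable_uCoeff hq0 hq1 1 hx⟩
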